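/- arXiv:quant-ph/0101040 — 5 statements merged into one kernel-verified Lean document; each statement's English description precedes it below -/
import Mathlib

section
/- Let α, β : ℕ → ℂ and let A be the infinite symmetric tridiagonal (Jacobi) matrix with entries A i i = α i, A i (i+1) = A (i+1) i = β i (indices i ≥ 1, 1-based), and A i j = 0 for |i−j| > 1. Let B : ℕ → ℕ → ℂ satisfy the inverse relation A·B = 1 entrywise, i.e. β (i−1) · B (i−1) j + α i · B i j + β i · B (i+1) j = δ_{ij} for all i, j ≥ 1 (with the term β (i−1) · B (i−1) j omitted when i = 1), and suppose B has the rank-structured form B i j = p i · q j for i ≤ j and B i j = p j · q i for j ≤ i, for some sequences p, q : ℕ → ℂ. Fix n ≥ 1 and assume B 1 n ≠ 0. Define the n×n matrices A_n = [A i j]_{i,j=1..n}, B_n = [B i j]_{i,j=1..n}, and F_n whose only nonzero entry is (F_n) n n = β n · (B 1 (n+1)) / (B 1 n). Then (A_n + F_n) · B_n = 1 (the n×n identity matrix); in particular B_n = (A_n + F_n)⁻¹. -/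
/-- A row of a truncated tridiagonal matrix applied to a vector (indices are 1-based). -/
theorem sum_range_tridiagonal_mul
    (α β : ℕ → ℂ) (A : ℕ → ℕ → ℂ) (f : ℕ → ℂ) (n i : ℕ) (hi : i ≤ n)
    (hdiag : ∀ i, 1 ≤ i → A i i = α i)
    (hsup : ∀ i, 1 ≤ i → A i (i + 1) = β i)
    (hsub : ∀ i, 1 ≤ i → A (i + 1) i = β i)
    (hzero : ∀ i j, 1 ≤ i → 1 ≤ j → i + 1 < j ∨ j + 1 < i → A i j = 0) :
    ∑ k ∈ Finset.range (n + 1), A (i + 1) (k + 1) * f (k + 1) =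
      (if i = 0 then 0 else β i * f i) + α (i + 1) * f (i + 1) +
        (if i < n then β (i + 1) * f (i + 2) else 0) := by
  have entry (k : ℕ) : A (i + 1) (k + 1) * f (k + 1) =
      (if k = i - 1 then (if i = 0 then 0 else β i * f i) else 0) +
        (if k = i then α (i + 1) * f (i + 1) else 0) +
        (if k = i + 1 then β (i + 1) * f (i + 2) else 0) := by
    by_cases hk : i + 1 < k ∨ k + 1 < i
    · rw [hzero (i + 1) (k + 1) (by omega) (by omega) (by omega), if_neg (by omega),
        if_neg (by omega), if_neg (by omega)]
      simp
    · obtain rfl | rfl | rfl : k = i ∨ k = i + 1 ∨ i = k + 1 := by omega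
      · rw [hdiag _ (by omega)]
        by_cases h : k = 0
        · simp [h]
        · simp [show k ≠ k - 1 by omega]
      · rw [hsup _ (by omega)]
        simp [show i + 1 ≠ i - 1 by omega]
      · rw [hsub _ (by omega)]
        simp [show k ≠ k + 1 + 1 by omega]
  simp only [entry, Finset.sum_add_distrib, Finset.sum_ite_eq', Finset.mem_range]
  rw [if_pos (by omega : i - 1 < n + 1), if_pos (by omega : i < n + 1)]
  simp

/-- Truncated inverse of an infinite symmetric tridiagonal (Jacobi) matrix.
Indices are 1-based; the truncation size is `n + 1` (so `n + 1 ≥ 1` automatically).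
`A` is the Jacobi matrix built from the diagonal `α` and off-diagonal `β`,
`B` is its entrywise inverse, which has the rank-structured form
`B i j = p (min i j) * q (max i j)`.  Then `(Aₙ + Fₙ) * Bₙ = 1`, where `Fₙ` has a
single nonzero entry `β (n+1) * B 1 (n+2) / B 1 (n+1)` in the lower right corner. -/
theorem truncated_inverse_of_jacobi_matrix
    (α β : ℕ → ℂ) (A : ℕ → ℕ → ℂ) (B : ℕ → ℕ → ℂ) (p q : ℕ → ℂ) (n : ℕ)
    -- A is the symmetric tridiagonal matrix with diagonal α and off-diagonal β (1-based)
    (hdiag : ∀ i, 1 ≤ i → A i i = α i)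
    (hsup : ∀ i, 1 ≤ i → A i (i + 1) = β i)
    (hsub : ∀ i, 1 ≤ i → A (i + 1) i = β i)
    (hzero : ∀ i j, 1 ≤ i → 1 ≤ j → i + 1 < j ∨ j + 1 < i → A i j = 0)
    -- the inverse relation A·B = 1, written entrywise (first row, then general rows)
    (hinv1 : ∀ j, 1 ≤ j →
      α 1 * B 1 j + β 1 * B 2 j = if 1 = j then (1 : ℂ) else 0)
    (hinv : ∀ i j, 1 ≤ i → 1 ≤ j →
      β i * B i j + α (i + 1) * B (i + 1) j + β (i + 1) * B (i + 2) j =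
        if i + 1 = j then (1 : ℂ) else 0)
    -- rank structure of the inverse of a symmetric tridiagonal matrix
    (hBle : ∀ i j, 1 ≤ i → i ≤ j → B i j = p i * q j)
    (hBge : ∀ i j, 1 ≤ j → j ≤ i → B i j = p j * q i)
    -- nondegeneracy of the corner ratio
    (hB1n : B 1 (n + 1) ≠ 0) :
    -- the truncated matrices (of size (n+1) × (n+1), entries 1-based)
    ((Matrix.of fun i j : Fin (n + 1) => A (i.1 + 1) (j.1 + 1)) +
        (Matrix.of fun i j : Fin (n + 1) =>
          if i = Fin.last n ∧ j = Fin.last n then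
            β (n + 1) * B 1 (n + 2) / B 1 (n + 1) else 0)) *
      (Matrix.of fun i j : Fin (n + 1) => B (i.1 + 1) (j.1 + 1)) = 1 := by
  ext i j
  obtain ⟨i, hi⟩ := i
  obtain ⟨j, hj⟩ := j
  have row : α (i + 1) * B (i + 1) (j + 1) + (if i = 0 then 0 else β i * B i (j + 1)) +
      β (i + 1) * B (i + 2) (j + 1) = if i = j then 1 else 0 := by
    rcases i with _ | i
    · simpa [eq_comm] using hinv1 (j + 1) (by omega)
    · have h := hinv (i + 1) (j + 1) (by omega) (by omega)
      simp only [Nat.add_right_cancel_iff] at h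
      rw [← h, if_neg (by omega)]
      ring
  rw [Matrix.add_mul, Matrix.add_apply, Matrix.mul_apply, Matrix.mul_apply]
  simp only [Matrix.of_apply, Matrix.one_apply, Fin.mk.injEq]
  rw [Fin.sum_univ_eq_sum_range (fun k => A (i + 1) (k + 1) * B (k + 1) (j + 1)) (n + 1),
    sum_range_tridiagonal_mul α β A (fun k => B k (j + 1)) n i (by omega) hdiag hsup hsub hzero,
    ← row]
  by_cases h : i = n
  · subst h
    have corner : β (i + 1) * B 1 (i + 2) / B 1 (i + 1) * B (i + 1) (j + 1) =
        β (i + 1) * B (i + 2) (j + 1) := by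
      rw [div_mul_eq_mul_div, div_eq_iff hB1n, hBle 1 (i + 2) le_rfl (by omega),
        hBle 1 (i + 1) le_rfl (by omega), hBge (i + 1) (j + 1) (by omega) (by omega),
        hBge (i + 2) (j + 1) (by omega) (by omega)]
      ring
    have hlast : (⟨i, hi⟩ : Fin (i + 1)) = Fin.last i := rfl
    simp only [hlast, true_and, ite_mul, zero_mul, Finset.sum_ite_eq', Finset.mem_univ, if_true,
      Fin.val_last, corner, lt_irrefl, if_false]
    ring
  · have hlast : (⟨i, hi⟩ : Fin (n + 1)) ≠ Fin.last n := fun e => h (congrArg Fin.val e)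
    simp only [hlast, false_and, if_false, zero_mul, Finset.sum_const_zero,
      if_pos (show i < n by omega)]
    ring
end

section
/- Let a, b : ℕ → ℂ with a n ≠ 0 for all n ≥ 1, and let d be a solution of the three-term recurrence x (n+1) = b n · x n + a n · x (n−1) (n ≥ 1) with d n ≠ 0 for all sufficiently large n. If m and m′ are solutions of the recurrence, both not identically zero, with m n / d n → 0 and m′ n / d n → 0 as n → ∞, then m′ = c · m for some nonzero c ∈ ℂ; i.e. the minimal solution is unique up to a nonzero scalar multiple. -/
open Filter

/-- A solution of a three-term recurrence that vanishes at `0` and `1` is identically zero. -/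
theorem eq_zero_of_three_term_recurrence {R : Type*} [Semiring R] {a b x : ℕ → R}
    (hx : ∀ n, x (n + 2) = b (n + 1) * x (n + 1) + a (n + 1) * x n)
    (h0 : x 0 = 0) (h1 : x 1 = 0) (n : ℕ) : x n = 0 := by
  induction n using Nat.twoStepInduction with
  | zero => exact h0
  | one => exact h1
  | more n ih ih' => rw [hx, ih, ih', mul_zero, mul_zero, add_zero]

/-- Uniqueness of the minimal solution up to a nonzero scalar: if `m` and `m'` are
nontrivial solutions of the three-term recurrence that are both minimal with respect
to a dominant solution `d`, then `m' = c • m` for some nonzero scalar `c`. -/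
theorem minimal_solution_unique_up_to_scalar
    (a b : ℕ → ℂ) (ha : ∀ n, 1 ≤ n → a n ≠ 0)
    (d m m' : ℕ → ℂ)
    (hd : ∀ n, d (n + 2) = b (n + 1) * d (n + 1) + a (n + 1) * d n)
    (hdne : ∀ᶠ n in atTop, d n ≠ 0)
    (hm : ∀ n, m (n + 2) = b (n + 1) * m (n + 1) + a (n + 1) * m n)
    (hm' : ∀ n, m' (n + 2) = b (n + 1) * m' (n + 1) + a (n + 1) * m' n)
    (hmne : m ≠ fun _ => 0) (hm'ne : m' ≠ fun _ => 0)
    (hmin : Tendsto (fun n => m n / d n) atTop (nhds 0))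
    (hmin' : Tendsto (fun n => m' n / d n) atTop (nhds 0)) :
    ∃ c : ℂ, c ≠ 0 ∧ ∀ n, m' n = c * m n := by
  have hW : m 0 * m' 1 - m 1 * m' 0 = 0 := by
    have hcomb : ∀ n, (m 0 * m' 1 - m 1 * m' 0) * d n
        - ((d 0 * m' 1 - d 1 * m' 0) * m n + (m 0 * d 1 - m 1 * d 0) * m' n) = 0 :=
      eq_zero_of_three_term_recurrence (a := a) (b := b)
        (fun n => by rw [hd, hm, hm']; ring) (by ring) (by ring)
    have hlim := (hmin.const_mul (d 0 * m' 1 - d 1 * m' 0)).add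
      (hmin'.const_mul (m 0 * d 1 - m 1 * d 0))
    rw [mul_zero, mul_zero, add_zero] at hlim
    refine tendsto_nhds_unique (tendsto_const_nhds.congr' ?_) hlim
    filter_upwards [hdne] with n hn
    field_simp
    linear_combination hcomb n
  have huniq : ∀ c, m' 0 = c * m 0 → m' 1 = c * m 1 →
      ∃ c : ℂ, c ≠ 0 ∧ ∀ n, m' n = c * m n := by
    intro c h0 h1
    have hc : ∀ n, m' n = c * m n := fun n => sub_eq_zero.mp <|
      eq_zero_of_three_term_recurrence (a := a) (b := b) (x := fun n => m' n - c * m n)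
        (fun n => by simp only [hm, hm']; ring) (sub_eq_zero.mpr h0) (sub_eq_zero.mpr h1) n
    refine ⟨c, ?_, hc⟩
    rintro rfl
    exact hm'ne (funext fun n => by rw [hc, zero_mul])
  by_cases h0 : m 0 = 0
  · have h1 : m 1 ≠ 0 := fun h1 => hmne (funext (eq_zero_of_three_term_recurrence hm h0 h1))
    refine huniq (m' 1 / m 1) ?_ (div_mul_cancel₀ _ h1).symm
    field_simp
    linear_combination -hW
  · refine huniq (m' 0 / m 0) (div_mul_cancel₀ _ h0).symm ?_
    field_simp
    linear_combination hW
end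

section
/- (Pincherle's theorem, convergence implies minimality.) Let a, b : ℕ → ℂ with a n ≠ 0 for all n ≥ 1, and define the canonical numerators and denominators by A₋₁ = 1, A₀ = 0, B₋₁ = 0, B₀ = 1, and A n = b n · A (n−1) + a n · A (n−2), B n = b n · B (n−1) + a n · B (n−2) for n ≥ 1 (so A n / B n is the n-th approximant of the continued fraction K_{n=1}^∞ (a n / b n)). Suppose B n ≠ 0 for all sufficiently large n and that A n / B n converges to some f ∈ ℂ as n → ∞. Then the three-term recurrence x (n+1) = b n · x n + a n · x (n−1) (n ≥ 1) has a minimal solution: there exist a solution m, not identically zero, and a solution d with d n ≠ 0 for all sufficiently large n, such that m n / d n → 0 as n → ∞. -/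
open Filter

/-- Pincherle's theorem (convergence implies existence of a minimal solution).
The canonical numerators `A` and denominators `B` are indexed with a shift by one,
so that `A 0 = A₋₁ = 1`, `A 1 = A₀ = 0`, `B 0 = B₋₁ = 0`, `B 1 = B₀ = 1`, and the
`n`-th approximant of `K (a n / b n)` is `A (n+1) / B (n+1)`.  If the approximants
converge to some `f ∈ ℂ`, then the three-term recurrence
`x (n+1) = b n * x n + a n * x (n-1)` has a minimal solution. -/
theorem pincherle_convergence_implies_minimal_solution
    (a b : ℕ → ℂ) (ha : ∀ n, 1 ≤ n → a n ≠ 0)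
    (A B : ℕ → ℂ)
    (hA0 : A 0 = 1) (hA1 : A 1 = 0)
    (hB0 : B 0 = 0) (hB1 : B 1 = 1)
    (hArec : ∀ n, A (n + 2) = b (n + 1) * A (n + 1) + a (n + 1) * A n)
    (hBrec : ∀ n, B (n + 2) = b (n + 1) * B (n + 1) + a (n + 1) * B n)
    (hBne : ∀ᶠ n in atTop, B (n + 1) ≠ 0)
    (f : ℂ)
    (hconv : Tendsto (fun n => A (n + 1) / B (n + 1)) atTop (nhds f)) :
    ∃ m d : ℕ → ℂ,
      (∀ n, m (n + 2) = b (n + 1) * m (n + 1) + a (n + 1) * m n) ∧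
      (∀ n, d (n + 2) = b (n + 1) * d (n + 1) + a (n + 1) * d n) ∧
      m ≠ (fun _ => 0) ∧
      (∀ᶠ n in atTop, d n ≠ 0) ∧
      Tendsto (fun n => m n / d n) atTop (nhds 0) := by
  have hB : ∀ᶠ n in atTop, B n ≠ 0 := by
    obtain ⟨N, hN⟩ := eventually_atTop.1 hBne
    refine eventually_atTop.2 ⟨N + 1, fun n hn => ?_⟩
    obtain ⟨k, rfl⟩ := Nat.exists_eq_add_of_le' (show 1 ≤ n by omega)
    exact hN k (by omega)
  refine ⟨fun n => A n - f * B n, B, fun n => ?_, hBrec, fun h => ?_, hB, ?_⟩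
  · simp only [hArec, hBrec]
    ring
  · simpa [hA0, hB0] using congrFun h 0
  · have hAB : Tendsto (fun n => A n / B n) atTop (nhds f) :=
      (tendsto_add_atTop_iff_nat 1).1 hconv
    have hsub : Tendsto (fun n => A n / B n - f) atTop (nhds 0) := by
      simpa using hAB.sub_const f
    refine hsub.congr' ?_
    filter_upwards [hB] with n hn
    rw [sub_div, mul_div_cancel_right₀ f hn]
end

section
/- (Pincherle's theorem, ratio formula.) Let a, b : ℕ → ℂ with a n ≠ 0 for all n ≥ 1, and suppose the three-term recurrence x (n+1) = b n · x n + a n · x (n−1) (n ≥ 1) has a minimal solution m with m N ≠ 0 for all N ≥ 0. Fix N ≥ 0 and define the tail numerators and denominators by A^{(N)}₋₁ = 1, A^{(N)}₀ = 0, B^{(N)}₋₁ = 0, B^{(N)}₀ = 1, and A^{(N)} n = b (n+N) · A^{(N)} (n−1) + a (n+N) · A^{(N)} (n−2), B^{(N)} n = b (n+N) · B^{(N)} (n−1) + a (n+N) · B^{(N)} (n−2) for n ≥ 1. If B^{(N)} n ≠ 0 for all sufficiently large n, then A^{(N)} n / B^{(N)} n → − m (N+1) / m N as n → ∞; that is,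 the tail continued fraction K_{n=1}^∞ (a (n+N) / b (n+N)) converges to − m (N+1) / m N. -/
open Filter

/-- Every solution of the three-term recurrence is, from index `N` on, the combination of the
tail numerators and denominators with coefficients its values at `N` and `N + 1`. -/
theorem solution_eq_tail_combination {R : Type*} [CommRing R] {a b x A B : ℕ → R} {N : ℕ}
    (hx : ∀ n, x (n + 2) = b (n + 1) * x (n + 1) + a (n + 1) * x n)
    (hA0 : A 0 = 1) (hA1 : A 1 = 0) (hB0 : B 0 = 0) (hB1 : B 1 = 1)
    (hArec : ∀ n, A (n + 2) = b (n + 1 + N) * A (n + 1) + a (n + 1 + N) * A n)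
    (hBrec : ∀ n, B (n + 2) = b (n + 1 + N) * B (n + 1) + a (n + 1 + N) * B n) (n : ℕ) :
    x (n + N) = x N * A n + x (N + 1) * B n := by
  induction n using Nat.twoStepInduction with
  | zero => simp [hA0, hB0]
  | one => simp [hA1, hB1, Nat.add_comm 1 N]
  | more n ih₀ ih₁ =>
    rw [show n + 2 + N = n + N + 2 by omega, hx, hArec, hBrec,
      show n + N + 1 = n + 1 + N by omega, ih₀, ih₁]
    ring

/-- Pincherle's theorem (ratio formula).  Let `m` be a minimal solution of the
three-term recurrence `x (n+1) = b n * x n + a n * x (n-1)` with `m N ≠ 0` for all `N`.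
The tail numerators `A` and denominators `B` of the continued fraction
`K (a (n+N) / b (n+N))` are indexed with a shift by one, so that `A 0 = A₋₁ = 1`,
`A 1 = A₀ = 0`, `B 0 = B₋₁ = 0`, `B 1 = B₀ = 1`, and the `n`-th approximant is
`A (n+1) / B (n+1)`.  Then the approximants converge to `- m (N+1) / m N`. -/
theorem pincherle_ratio_formula
    (a b : ℕ → ℂ) (ha : ∀ n, 1 ≤ n → a n ≠ 0)
    (m : ℕ → ℂ)
    (hm : ∀ n, m (n + 2) = b (n + 1) * m (n + 1) + a (n + 1) * m n)
    (hmin : ∃ d : ℕ → ℂ,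
      (∀ n, d (n + 2) = b (n + 1) * d (n + 1) + a (n + 1) * d n) ∧
      (∀ᶠ n in atTop, d n ≠ 0) ∧
      Tendsto (fun n => m n / d n) atTop (nhds 0))
    (hmne : ∀ N, m N ≠ 0)
    (N : ℕ)
    (A B : ℕ → ℂ)
    (hA0 : A 0 = 1) (hA1 : A 1 = 0)
    (hB0 : B 0 = 0) (hB1 : B 1 = 1)
    (hArec : ∀ n, A (n + 2) = b (n + 1 + N) * A (n + 1) + a (n + 1 + N) * A n)
    (hBrec : ∀ n, B (n + 2) = b (n + 1 + N) * B (n + 1) + a (n + 1 + N) * B n)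
    (hBne : ∀ᶠ n in atTop, B (n + 1) ≠ 0) :
    Tendsto (fun n => A (n + 1) / B (n + 1)) atTop (nhds (-(m (N + 1) / m N))) := by
  obtain ⟨d, hd, hdne, hlim⟩ := hmin
  have hmAB := solution_eq_tail_combination hm hA0 hA1 hB0 hB1 hArec hBrec
  have hdAB := solution_eq_tail_combination hd hA0 hA1 hB0 hB1 hArec hBrec
  have hr : Tendsto (fun n => m (n + 1 + N) / d (n + 1 + N)) atTop (nhds 0) :=
    hlim.comp ((tendsto_add_atTop_nat N).comp (tendsto_add_atTop_nat 1))
  have hdne' : ∀ᶠ n in atTop, d (n + 1 + N) ≠ 0 :=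
    ((tendsto_add_atTop_nat N).comp (tendsto_add_atTop_nat 1)).eventually hdne
  have hden : Tendsto (fun n => m N - d N * (m (n + 1 + N) / d (n + 1 + N))) atTop
      (nhds (m N)) := by
    simpa using (hr.const_mul (d N)).const_sub (m N)
  have hnum : Tendsto (fun n => d (N + 1) * (m (n + 1 + N) / d (n + 1 + N)) - m (N + 1)) atTop
      (nhds (-m (N + 1))) := by
    simpa using (hr.const_mul (d (N + 1))).sub_const (m (N + 1))
  have hW : m N * d (N + 1) - d N * m (N + 1) ≠ 0 := by
    intro hW
    refine hmne N (tendsto_nhds_unique_of_eventuallyEq hden tendsto_const_nhds ?_)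
    filter_upwards [hdne'] with n hn
    field_simp
    rw [hmAB, hdAB]
    linear_combination B (n + 1) * hW
  rw [← neg_div]
  refine (hnum.div hden (hmne N)).congr' ?_
  filter_upwards [hdne'] with n hn
  rw [← mul_div_mul_left (A (n + 1)) (B (n + 1)) hW, Pi.div_apply, ← mul_div_mul_left _ _ hn]
  congr 1 <;> field_simp <;> rw [hmAB, hdAB] <;> ring
end

section
/- (Bauer–Muir transformation.) Let a, b : ℕ → ℂ with a n ≠ 0 for all n ≥ 1, and let w : ℕ → ℂ (with n-th index w n, n ≥ 0). Define λ n = a n − w (n−1) · (b n + w n) for n ≥ 1, and assume λ n ≠ 0 for all n ≥ 1; set q n = λ (n+1) / λ n for n ≥ 1. Define the transformed coefficients d 0 = b 0 + w 0, c 1 = λ 1, d 1 = b 1 + w 1, and c n = a (n−1) · q (n−1), d n = b n + w n − w (n−2) · q (n−1) for n ≥ 2. Let A n, B n be the canonical numerators and denominators of b 0 + K(a n / b n) (A₋₁ = 1, A₀ = b 0, B₋₁ = 0, B₀ = 1, A n = b n · A (n−1) + a n · A (n−2), B n = b n · B (n−1) + a n · B (n−2)), and let C n, D n be the canonical numerators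 and denominators of d 0 + K(c n / d n) defined by the same recurrences from the coefficients c, d. Then for all n ≥ 0: C n = A n + A (n−1) · w n and D n = B n + B (n−1) · w n. In particular, whenever D n ≠ 0, the n-th classical approximant C n / D n of the transformed continued fraction equals the modified approximant S n (w n) = (A n + A (n−1) · w n)/(B n + B (n−1) · w n) of the original continued fraction. -/
/-- If `X` solves the recurrence of `K (a n / b n)` and `Y` that of its Bauer–Muir transform, then
`Y (n + 1) = X (n + 1) + X n * w n` holds for all `n` as soon as it holds for `n = 0, 1`. -/
theorem bauer_muir_recurrence {K : Type*} [Field K] {a b w lam q c d X Y : ℕ → K}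
    (hlamdef : ∀ n, lam (n + 1) = a (n + 1) - w n * (b (n + 1) + w (n + 1)))
    (hlam : ∀ n, lam (n + 1) ≠ 0)
    (hq : ∀ n, q (n + 1) = lam (n + 2) / lam (n + 1))
    (hc : ∀ n, c (n + 2) = a (n + 1) * q (n + 1))
    (hd : ∀ n, d (n + 2) = b (n + 2) + w (n + 2) - w n * q (n + 1))
    (hX : ∀ n, X (n + 2) = b (n + 1) * X (n + 1) + a (n + 1) * X n)
    (hY : ∀ n, Y (n + 2) = d (n + 1) * Y (n + 1) + c (n + 1) * Y n)
    (h0 : Y 1 = X 1 + X 0 * w 0) (h1 : Y 2 = X 2 + X 1 * w 1) (n : ℕ) :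
    Y (n + 1) = X (n + 1) + X n * w n := by
  induction n using Nat.twoStepInduction with
  | zero => exact h0
  | one => exact h1
  | more n ih₀ ih₁ =>
    have hqlam : q (n + 1) * lam (n + 1) = lam (n + 2) := by
      rw [hq, div_mul_cancel₀ _ (hlam n)]
    rw [hlamdef n, hlamdef (n + 1)] at hqlam
    rw [hY (n + 1), hd, hc, ih₀, ih₁, hX (n + 1), hX n]
    linear_combination X (n + 1) * hqlam

/-- Bauer–Muir transformation.  With `lam n = a n - w (n-1) * (b n + w n)` (for `n ≥ 1`)
all nonzero, `q n = lam (n+1) / lam n`, and transformed coefficients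
`d 0 = b 0 + w 0`, `c 1 = lam 1`, `d 1 = b 1 + w 1`,
`c n = a (n-1) * q (n-1)`, `d n = b n + w n - w (n-2) * q (n-1)` for `n ≥ 2`,
the canonical numerators/denominators `C`, `D` of `d 0 + K (c n / d n)` satisfy
`C n = A n + A (n-1) * w n` and `D n = B n + B (n-1) * w n`, where `A`, `B` are the
canonical numerators/denominators of `b 0 + K (a n / b n)`.  All four sequences are
indexed with a shift by one (`A 0 = A₋₁ = 1`, `A 1 = A₀ = b 0`, etc.), so the paper's
index `n` corresponds to `n + 1` here.  In particular the classical approximants of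
the transformed fraction equal the modified approximants of the original one. -/
theorem bauer_muir_transformation
    (a b w : ℕ → ℂ) (ha : ∀ n, 1 ≤ n → a n ≠ 0)
    (lam q c d : ℕ → ℂ)
    (hlamdef : ∀ n, lam (n + 1) = a (n + 1) - w n * (b (n + 1) + w (n + 1)))
    (hlam : ∀ n, lam (n + 1) ≠ 0)
    (hq : ∀ n, q (n + 1) = lam (n + 2) / lam (n + 1))
    (hd0 : d 0 = b 0 + w 0)
    (hc1 : c 1 = lam 1)
    (hd1 : d 1 = b 1 + w 1)
    (hc : ∀ n, c (n + 2) = a (n + 1) * q (n + 1))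
    (hd : ∀ n, d (n + 2) = b (n + 2) + w (n + 2) - w n * q (n + 1))
    (A B C D : ℕ → ℂ)
    (hA0 : A 0 = 1) (hA1 : A 1 = b 0)
    (hB0 : B 0 = 0) (hB1 : B 1 = 1)
    (hArec : ∀ n, A (n + 2) = b (n + 1) * A (n + 1) + a (n + 1) * A n)
    (hBrec : ∀ n, B (n + 2) = b (n + 1) * B (n + 1) + a (n + 1) * B n)
    (hC0 : C 0 = 1) (hC1 : C 1 = d 0)
    (hD0 : D 0 = 0) (hD1 : D 1 = 1)
    (hCrec : ∀ n, C (n + 2) = d (n + 1) * C (n + 1) + c (n + 1) * C n)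
    (hDrec : ∀ n, D (n + 2) = d (n + 1) * D (n + 1) + c (n + 1) * D n) :
    (∀ n, C (n + 1) = A (n + 1) + A n * w n ∧ D (n + 1) = B (n + 1) + B n * w n) ∧
      (∀ n, D (n + 1) ≠ 0 →
        C (n + 1) / D (n + 1) = (A (n + 1) + A n * w n) / (B (n + 1) + B n * w n)) := by
  have hCD : ∀ n, C (n + 1) = A (n + 1) + A n * w n ∧ D (n + 1) = B (n + 1) + B n * w n := by
    refine fun n => ⟨bauer_muir_recurrence hlamdef hlam hq hc hd hArec hCrec ?_ ?_ n,
      bauer_muir_recurrence hlamdef hlam hq hc hd hBrec hDrec ?_ ?_ n⟩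
    · rw [hC1, hd0, hA1, hA0, one_mul]
    · rw [hCrec 0, hArec 0, hC1, hC0, hA1, hA0, hd0, hd1, hc1, hlamdef 0]
      ring
    · rw [hD1, hB1, hB0, zero_mul, add_zero]
    · rw [hDrec 0, hBrec 0, hD1, hD0, hB1, hB0, hd1]
      ring
  exact ⟨hCD, fun n _ => by rw [(hCD n).1, (hCD n).2]⟩
end
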